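/- arXiv:2105.03130 — 2 statements merged into one kernel-verified Lean document; each statement's English description precedes it below -/
import Mathlib

section
/- Let $(X,\mathcal{B}_X,\mu,T)$ be a $\mathbb{Z}^2$-MPS and let $\vec v=(1,\beta_1)$, $\vec w=(1,\beta_2)$ be direction vectors with $\beta_1\ne\beta_2$. If $B\in\mathcal{K}^{\vec v}_\mu\cap\mathcal{K}^{\vec w}_\mu$, then $\overline{\{U_T^{(m,n)}1_B:(m,n)\in\mathbb{Z}^2\}}$ is a compact subset of $L^2(X,\mathcal{B}_X,\mu)$; that is, $B$ belongs to the classical Kronecker algebra $\mathcal{K}_\mu$. -/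
open MeasureTheory Filter Set
open scoped ENNReal Topology

namespace Directional

noncomputable section

attribute [local instance] Classical.propDecidable

variable {X : Type*} [MeasurableSpace X] {G : Type*}

/-- The set of Koopman images `U_T^w 1_B` for `w ∈ Λ`, as elements of `L²(μ)`. -/
def korbit (μ : Measure X) (T : G → X → X) (Λ : Set G) (B : Set X) :
    Set (Lp ℝ 2 μ) :=
  {g | ∃ w ∈ Λ, (g : X → ℝ) =ᵐ[μ] fun x => B.indicator (fun _ => (1 : ℝ)) (T w x)}

/-- A finite measurable partition of `X`. -/
def IsPartition (α : Finset (Set X)) : Prop :=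
  (∀ A ∈ α, MeasurableSet A) ∧ ((α : Set (Set X)).PairwiseDisjoint id) ∧
    ⋃₀ (α : Set (Set X)) = Set.univ

/-- Static entropy `H_μ(α) = -∑ μ(A) log μ(A)`. -/
def partEnt (μ : Measure X) (α : Finset (Set X)) : ℝ :=
  ∑ A ∈ α, Real.negMulLog (μ A).toReal

/-- The join `⋁_{i=1}^k T^{-w_i} α`. -/
def seqJoin (T : G → X → X) (w : ℕ → G) (α : Finset (Set X)) : ℕ → Finset (Set X)
  | 0 => {Set.univ}
  | k + 1 => ((seqJoin T w α k) ×ˢ α).image fun p => p.1 ∩ (T (w k) ⁻¹' p.2)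

/-- Sequence entropy `h^S_μ(T, α)` along the sequence `w` for the partition `α`. -/
def seqEnt (μ : Measure X) (T : G → X → X) (w : ℕ → G) (α : Finset (Set X)) : ℝ :=
  Filter.atTop.limsup fun k : ℕ => partEnt μ (seqJoin T w α k) / (k : ℝ)

/-- Sequence entropy `h^S_μ(T)`, as the supremum over all finite measurable
partitions (valued in `ℝ≥0∞`). -/
def seqEntSup (μ : Measure X) (T : G → X → X) (w : ℕ → G) : ℝ≥0∞ :=
  ⨆ α : {α : Finset (Set X) // IsPartition α}, ENNReal.ofReal (seqEnt μ T w α)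

/-- `w : ℕ → G` is an enumeration of an infinite subset of `Λ`. -/
def EnumIn (w : ℕ → G) (Λ : Set G) : Prop :=
  Function.Injective w ∧ ∀ i, w i ∈ Λ

/-- Conditional entropy `H_μ(α | F)` with respect to a sub-σ-algebra `F`. -/
def condEntAlg (μ : Measure X) (F : MeasurableSpace X) (α : Finset (Set X)) : ℝ :=
  ∑ A ∈ α, ∫ x, Real.negMulLog ((μ[A.indicator (fun _ => (1 : ℝ)) | F]) x) ∂μ

/-- Conditional entropy `H_μ(α | η)` of a partition given another partition. -/
def condEntPart (μ : Measure X) (α η : Finset (Set X)) : ℝ :=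
  -∑ A ∈ α, ∑ D ∈ η,
    (μ (A ∩ D)).toReal * Real.log ((μ (A ∩ D)).toReal / (μ D).toReal)

/-- A `ℤ²`-measure-preserving system: an action of `ℤ²` by homeomorphisms
(continuous maps with continuous inverses `T (-w)`), preserving `μ`. -/
def IsZ2MPS [TopologicalSpace X] (μ : Measure X) (T : ℤ × ℤ → X → X) : Prop :=
  (∀ w, Continuous (T w)) ∧ T 0 = _root_.id ∧ (∀ v w, T (v + w) = T v ∘ T w) ∧
    ∀ w, MeasurePreserving (T w) μ μ

/-- The strip `Λ^{(1,β)}(b) = {(m,n) : βm - b/2 ≤ n ≤ βm + b/2}`. -/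
def Lam (β b : ℝ) : Set (ℤ × ℤ) :=
  {p | β * (p.1 : ℝ) - b / 2 ≤ (p.2 : ℝ) ∧ (p.2 : ℝ) ≤ β * (p.1 : ℝ) + b / 2}

/-- The `(1,β)`-directional Kronecker algebra with width parameter `b`. -/
def dirKron (μ : Measure X) (T : ℤ × ℤ → X → X) (β b : ℝ) : Set (Set X) :=
  {B | MeasurableSet B ∧ IsCompact (closure (korbit μ T (Lam β b) B))}

/-- The directional Kronecker algebra as a σ-algebra (using width `b = 1`,
which is immaterial since `dirKron` is independent of `b`). -/
def dirKronAlg (μ : Measure X) (T : ℤ × ℤ → X → X) (β : ℝ) : MeasurableSpace X :=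
  MeasurableSpace.generateFrom (dirKron μ T β 1)

/-- The classical Kronecker algebra of the `ℤ²`-system. -/
def kron (μ : Measure X) (T : ℤ × ℤ → X → X) : Set (Set X) :=
  {B | MeasurableSet B ∧ IsCompact (closure (korbit μ T Set.univ B))}

/-- `h^{v,*}_μ(α)`: supremum of directional sequence entropies of `α` over all
infinite subsets of the strip (width `1`, immaterial). -/
def hStar (μ : Measure X) (T : ℤ × ℤ → X → X) (β : ℝ) (α : Finset (Set X)) : ℝ :=
  ⨆ w : {w : ℕ → ℤ × ℤ // EnumIn w (Lam β 1)}, seqEnt μ T w.1 α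

/-- The two-element partition `{B, Bᶜ}`. -/
def pairPart (B : Set X) : Finset (Set X) := {B, Bᶜ}

/-- The pulled-back partition `T^{-g} α = {T_g⁻¹ A : A ∈ α}`. -/
def pullPart (T : G → X → X) (g : G) (α : Finset (Set X)) : Finset (Set X) :=
  α.image fun A => T g ⁻¹' A

end
section TranslationInvariant

variable {G E : Type*} [AddCommGroup G] [PseudoMetricSpace E] {φ : G → E}

/-- For a map with translation invariant distances, the image of a sum of two sets with totally
bounded images is totally bounded. -/
lemma totallyBounded_image2_add
    (hφ : ∀ u v w, dist (φ (v + u)) (φ (w + u)) = dist (φ v) (φ w)) {A C : Set G}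
    (hA : TotallyBounded (φ '' A)) (hC : TotallyBounded (φ '' C)) :
    TotallyBounded (φ '' Set.image2 (· + ·) A C) := by
  rw [Metric.totallyBounded_iff]
  intro ε hε
  obtain ⟨s, hsA, hs, hAs⟩ := Metric.finite_approx_of_totallyBounded hA (ε / 2) (half_pos hε)
  obtain ⟨t, htC, ht, hCt⟩ := Metric.finite_approx_of_totallyBounded hC (ε / 2) (half_pos hε)
  obtain ⟨s, -, hs', rfl⟩ := Set.exists_subset_image_finite_and.1 ⟨s, hsA, hs, rfl⟩
  obtain ⟨t, -, ht', rfl⟩ := Set.exists_subset_image_finite_and.1 ⟨t, htC, ht, rfl⟩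
  refine ⟨φ '' Set.image2 (· + ·) s t, (hs'.image2 _ ht').image φ, ?_⟩
  rintro _ ⟨_, ⟨a, ha, c, hc, rfl⟩, rfl⟩
  obtain ⟨_, ⟨a', ha', rfl⟩, haa'⟩ := Set.mem_iUnion₂.1 (hAs ⟨a, ha, rfl⟩)
  obtain ⟨_, ⟨c', hc', rfl⟩, hcc'⟩ := Set.mem_iUnion₂.1 (hCt ⟨c, hc, rfl⟩)
  refine Set.mem_iUnion₂.2 ⟨_, ⟨_, ⟨a', ha', c', hc', rfl⟩, rfl⟩, ?_⟩
  rw [Metric.mem_ball] at *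
  calc dist (φ (a + c)) (φ (a' + c'))
      ≤ dist (φ (a + c)) (φ (a' + c)) + dist (φ (a' + c)) (φ (a' + c')) := dist_triangle _ _ _
    _ = dist (φ a) (φ a') + dist (φ c) (φ c') := by
      rw [hφ, add_comm a' c, add_comm a' c', hφ]
    _ < ε := by linarith

end TranslationInvariant

/-- Two strips in different directions span `ℤ²` up to a finite set. -/
lemma exists_finite_forall_exists_mem_Lam_add {β₁ β₂ : ℝ} (hβ : β₁ ≠ β₂) :
    ∃ F : Set (ℤ × ℤ), F.Finite ∧
      Set.image2 (· + ·) (Set.image2 (· + ·) (Lam β₁ 1) (Lam β₂ 1)) F = Set.univ := by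
  obtain ⟨N, hN⟩ := exists_nat_ge (|β₁ - β₂| / 2 + 1)
  refine ⟨{0} ×ˢ Set.Icc (-(N : ℤ)) N, (Set.finite_singleton _).prod (Set.finite_Icc _ _), ?_⟩
  have mem_Lam (β : ℝ) (k : ℤ) : (k, round (β * k)) ∈ Lam β 1 := by
    have h := abs_le.1 (abs_sub_round (β * k))
    constructor <;> dsimp only <;> linarith [h.1, h.2]
  refine Set.eq_univ_of_forall fun ⟨m, n⟩ => ?_
  have hβ' : β₁ - β₂ ≠ 0 := sub_ne_zero.2 hβ
  set s : ℝ := (n - β₂ * m) / (β₁ - β₂) with hs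
  set k : ℤ := round s
  refine ⟨_, ⟨_, mem_Lam β₁ k, _, mem_Lam β₂ (m - k), rfl⟩,
    (0, n - round (β₁ * k) - round (β₂ * (m - k : ℤ))), ⟨rfl, ?_⟩, ?_⟩
  · have h₁ := abs_le.1 (abs_sub_round (β₁ * k))
    have h₂ := abs_le.1 (abs_sub_round (β₂ * (m - k : ℤ)))
    have h₃ : |(β₁ - β₂) * (s - k)| ≤ |β₁ - β₂| / 2 := by
      rw [abs_mul]
      have := mul_le_mul_of_nonneg_left (abs_sub_round s) (abs_nonneg (β₁ - β₂))
      linarith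
    have h₄ : (β₁ - β₂) * (s - k) = n - β₁ * k - β₂ * (m - k : ℤ) := by
      rw [mul_sub, hs, mul_div_cancel₀ _ hβ']
      push_cast
      ring
    rw [h₄] at h₃
    have h₅ := abs_le.1 h₃
    constructor <;> dsimp only <;> rify <;> push_cast at * <;>
      linarith [h₁.1, h₁.2, h₂.1, h₂.2, h₅.1, h₅.2]
  · ext <;> simp

section Koopman

variable {X : Type*} [MeasurableSpace X] {μ : Measure X} [IsFiniteMeasure μ] {G : Type*}
  {T : G → X → X} {B : Set X}

/-- The Koopman image `U_T^w 1_B`. -/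
noncomputable def koopmanIndicator (hT : ∀ w, MeasurePreserving (T w) μ μ)
    (hB : MeasurableSet B) (w : G) : Lp ℝ 2 μ :=
  Lp.compMeasurePreserving (T w) (hT w) (indicatorConstLp 2 hB (measure_ne_top μ B) 1)

lemma coeFn_koopmanIndicator (hT : ∀ w, MeasurePreserving (T w) μ μ)
    (hB : MeasurableSet B) (w : G) :
    koopmanIndicator hT hB w =ᵐ[μ] fun x => B.indicator (fun _ => (1 : ℝ)) (T w x) :=
  (Lp.coeFn_compMeasurePreserving _ (hT w)).trans
    ((hT w).quasiMeasurePreserving.ae_eq_comp indicatorConstLp_coeFn)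

lemma korbit_eq_image (hT : ∀ w, MeasurePreserving (T w) μ μ) (hB : MeasurableSet B)
    (Λ : Set G) : korbit μ T Λ B = koopmanIndicator hT hB '' Λ := by
  ext g
  constructor
  · rintro ⟨w, hw, hg⟩
    exact ⟨w, hw, Lp.ext ((coeFn_koopmanIndicator hT hB w).trans hg.symm)⟩
  · rintro ⟨w, hw, rfl⟩
    exact ⟨w, hw, coeFn_koopmanIndicator hT hB w⟩

lemma dist_koopmanIndicator_add [Add G] (hT : ∀ w, MeasurePreserving (T w) μ μ)
    (hadd : ∀ v w, T (v + w) = T v ∘ T w) (hB : MeasurableSet B) (u v w : G) :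
    dist (koopmanIndicator hT hB (v + u)) (koopmanIndicator hT hB (w + u)) =
      dist (koopmanIndicator hT hB v) (koopmanIndicator hT hB w) := by
  have h (v : G) : koopmanIndicator hT hB (v + u) =
      Lp.compMeasurePreserving (T u) (hT u) (koopmanIndicator hT hB v) := by
    refine Lp.ext ((coeFn_koopmanIndicator hT hB _).trans ?_)
    refine .trans ?_ ((Lp.coeFn_compMeasurePreserving _ (hT u)).trans
      ((hT u).quasiMeasurePreserving.ae_eq_comp (coeFn_koopmanIndicator hT hB v))).symm
    simp [hadd, Function.comp_def]
  rw [h, h]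
  exact (Lp.isometry_compMeasurePreserving (hT u)).dist_eq _ _

end Koopman

/-- a set lying in the directional Kronecker algebras of two
distinct directions lies in the classical Kronecker algebra. -/
theorem mem_kron_of_mem_two_dirKron
    {X : Type*} [MetricSpace X] [CompactSpace X] [MeasurableSpace X] [BorelSpace X]
    (μ : Measure X) [IsProbabilityMeasure μ] (T : ℤ × ℤ → X → X)
    (hT : IsZ2MPS μ T) (β₁ β₂ : ℝ) (hβ : β₁ ≠ β₂) (B : Set X)
    (h₁ : B ∈ dirKron μ T β₁ 1) (h₂ : B ∈ dirKron μ T β₂ 1) :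
    IsCompact (closure (korbit μ T Set.univ B)) ∧ B ∈ kron μ T := by
  obtain ⟨-, -, hadd, hmp⟩ := hT
  obtain ⟨hB, hc₁⟩ := h₁
  have hc₂ := h₂.2
  suffices h : IsCompact (closure (korbit μ T Set.univ B)) from ⟨h, hB, h⟩
  obtain ⟨F, hF, hcover⟩ := exists_finite_forall_exists_mem_Lam_add hβ
  have hdist := dist_koopmanIndicator_add hmp hadd hB
  rw [korbit_eq_image hmp hB] at hc₁ hc₂ ⊢
  rw [← hcover]
  refine TotallyBounded.isCompact_of_isClosed (TotallyBounded.closure ?_) isClosed_closure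
  exact totallyBounded_image2_add hdist
    (totallyBounded_image2_add hdist (hc₁.totallyBounded.subset subset_closure)
      (hc₂.totallyBounded.subset subset_closure)) (hF.image _).totallyBounded

end Directional
end

section
/- Let $(X,\mathcal{B}_X,\mu,T)$ be a $\mathbb{Z}^2$-MPS, $\vec v=(1,\beta)\in\mathbb{R}^2$ a direction vector and $b\in(0,\infty)$. For every finite measurable partition $\mathfrak{C}=\{D_1,\dots,D_r\}$ of $X$ there exists an infinite subset $S'=\{(m'_i,n'_i)\}_{i=1}^\infty$ of $\Lambda^{\vec v}(b)$ with $\{m'_i\}_{i=1}^\infty$ strictly monotone such that for every $B\in\mathcal{B}_X$ and every $j\in\{1,\dots,r\}$, $\lim_{i\to\infty}\langle U_T^{(m'_i,n'_i)}(1_{D_j}-\mathbb{E}(1_{D_j}\mid\mathcal{K}^{\vec v}_\mu)),\,1_B\rangle=0$. -/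
open MeasureTheory Filter Set
open scoped ENNReal Topology

namespace Directional

noncomputable section

attribute [local instance] Classical.propDecidable

variable {X : Type*} [MeasurableSpace X] {G : Type*}

end

section WeakLimits

variable {H : Type*} [NormedAddCommGroup H] [InnerProductSpace ℝ H] {ι κ : Type*}

/-- Weak convergence of a family of vectors of a real Hilbert space along a filter. -/
def WeakLim (u : ι → H) (l : Filter ι) (g : H) : Prop :=
  ∀ h, Tendsto (fun i => inner ℝ (u i) h) l (𝓝 (inner ℝ g h))

theorem WeakLim.unique {u : ι → H} {l : Filter ι} [l.NeBot] {g g' : H}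
    (hg : WeakLim u l g) (hg' : WeakLim u l g') : g = g' :=
  ext_inner_right ℝ fun h => tendsto_nhds_unique (hg h) (hg' h)

theorem exists_weakLim [CompleteSpace H] {u : ι → H} {C : ℝ} (hu : ∀ i, ‖u i‖ ≤ C)
    (p : Ultrafilter ι) : ∃ g, WeakLim u p g := by
  have hbd : ∀ h i, ‖inner ℝ (u i) h‖ ≤ C * ‖h‖ := fun h i =>
    (norm_inner_le_norm _ _).trans (mul_le_mul_of_nonneg_right (hu i) (norm_nonneg h))
  have hlim : ∀ h, ∃ L ∈ Metric.closedBall (0 : ℝ) (C * ‖h‖),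
      Tendsto (fun i => inner ℝ (u i) h) p (𝓝 L) := fun h =>
    (isCompact_closedBall (0 : ℝ) (C * ‖h‖)).ultrafilter_le_nhds
      (p.map fun i => inner ℝ (u i) h) <| le_principal_iff.2 <|
        mem_map.2 <| univ_mem' fun i => mem_closedBall_zero_iff.2 (hbd h i)
  choose L hL hLt using hlim
  let φ : H →ₗ[ℝ] ℝ :=
    { toFun := L
      map_add' := fun h k => tendsto_nhds_unique (hLt (h + k)) <| by
        simpa only [inner_add_right] using (hLt h).add (hLt k)
      map_smul' := fun c h => tendsto_nhds_unique (hLt (c • h)) <| by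
        simpa only [inner_smul_right, smul_eq_mul, RingHom.id_apply] using (hLt h).const_mul c }
  refine ⟨(InnerProductSpace.toDual ℝ H).symm
    (φ.mkContinuous C fun h => mem_closedBall_zero_iff.1 (hL h)), fun h => ?_⟩
  rw [InnerProductSpace.toDual_symm_apply]
  exact hLt h

theorem WeakLim.norm_le {u : ι → H} {l : Filter ι} [l.NeBot] {g : H} (hg : WeakLim u l g)
    {c : ι → ℝ} {C : ℝ} (hc : Tendsto c l (𝓝 C)) (hu : ∀ i, ‖u i‖ ≤ c i) : ‖g‖ ≤ C := by
  have h : ‖g‖ * ‖g‖ ≤ C * ‖g‖ := by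
    rw [← real_inner_self_eq_norm_mul_norm]
    exact le_of_tendsto_of_tendsto' (hg g) (hc.mul_const _) fun i =>
      (real_inner_le_norm _ _).trans (mul_le_mul_of_nonneg_right (hu i) (norm_nonneg g))
  have hC : 0 ≤ C := ge_of_tendsto' hc fun i => (norm_nonneg _).trans (hu i)
  rcases (norm_nonneg g).eq_or_lt with h0 | h0
  · rwa [← h0]
  · exact le_of_mul_le_mul_right h h0

/-- Weak convergence without loss of norm is convergence in norm. -/
theorem WeakLim.tendsto {u : ι → H} {l : Filter ι} {g : H} (hg : WeakLim u l g)
    (hu : ∀ i, ‖u i‖ ≤ ‖g‖) : Tendsto u l (𝓝 g) := by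
  rw [tendsto_iff_norm_sub_tendsto_zero]
  have h1 : Tendsto (fun i => 2 * (‖g‖ ^ 2 - inner ℝ (u i) g)) l (𝓝 0) := by
    have := ((hg g).const_sub (‖g‖ ^ 2)).const_mul 2
    rwa [real_inner_self_eq_norm_sq, sub_self, mul_zero] at this
  have h2 : Tendsto (fun i => ‖u i - g‖ ^ 2) l (𝓝 0) := by
    refine squeeze_zero (fun i => sq_nonneg _) (fun i => ?_) h1
    rw [norm_sub_sq_real]
    nlinarith [pow_le_pow_left₀ (norm_nonneg _) (hu i) 2]
  have h3 := h2.sqrt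
  simpa only [Real.sqrt_zero, Real.sqrt_sq (norm_nonneg _)] using h3

theorem tendsto_of_tendsto_bind {a : ι → ℝ} {m : Filter κ} {l : κ → Filter ι}
    [∀ k, (l k).NeBot] {b : κ → ℝ} {L : ℝ} (hL : Tendsto a (m.bind l) (𝓝 L))
    (hb : ∀ k, Tendsto a (l k) (𝓝 (b k))) : Tendsto b m (𝓝 L) := by
  refine ((closed_nhds_basis L).tendsto_right_iff).2 fun s hs => ?_
  have h : ∀ᶠ k in m, ∀ᶠ i in l k, a i ∈ s := eventually_bind.1 (hL hs.1)
  exact h.mono fun k hk => hs.2.mem_of_tendsto (hb k) hk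

theorem WeakLim.of_bind {u : ι → H} {m : Filter κ} {l : κ → Filter ι} [∀ k, (l k).NeBot]
    {g' : κ → H} {g : H} (hg : WeakLim u (m.bind l) g) (hg' : ∀ k, WeakLim u (l k) (g' k)) :
    WeakLim g' m g :=
  fun h => tendsto_of_tendsto_bind (hg h) fun k => hg' k h

/-- Among the weak limits of an orbit along ultrafilters finer than a given filter, one has
minimal norm. -/
theorem exists_weakLim_norm_minimal [CompleteSpace H] (U : ι → H →ₗᵢ[ℝ] H) (F : Filter ι)
    [F.NeBot] (f : H) :
    ∃ (p : Ultrafilter ι) (g : H), (p : Filter ι) ≤ F ∧ WeakLim (fun w => U w f) p g ∧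
      ∀ (q : Ultrafilter ι) (g' : H), (q : Filter ι) ≤ F → WeakLim (fun w => U w f) q g' →
        ‖g‖ ≤ ‖g'‖ := by
  have hlim : ∀ p : Ultrafilter ι, ∃ g, WeakLim (fun w => U w f) p g :=
    exists_weakLim fun w => ((U w).norm_map f).le
  let S : Set ℝ := {c | ∃ (p : Ultrafilter ι) (g : H), (p : Filter ι) ≤ F ∧
    WeakLim (fun w => U w f) p g ∧ ‖g‖ = c}
  have hS : S.Nonempty := by
    obtain ⟨g, hg⟩ := hlim (Ultrafilter.of F)
    exact ⟨_, _, g, Ultrafilter.of_le F, hg, rfl⟩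
  have hbdd : BddBelow S := ⟨0, by rintro _ ⟨-, g, -, -, rfl⟩; exact norm_nonneg g⟩
  obtain ⟨u, -, hu, huS⟩ := exists_seq_tendsto_sInf hS hbdd
  choose p g hp hg hgu using huS
  obtain ⟨k, hk⟩ := hlim ((hyperfilter ℕ).bind p)
  have hgk : WeakLim g (hyperfilter ℕ) k :=
    WeakLim.of_bind (l := fun n => (p n : Filter ι)) hk hg
  have hkS : ‖k‖ ≤ sInf S :=
    hgk.norm_le (hu.mono_left Nat.hyperfilter_le_atTop) fun n => (hgu n).le
  refine ⟨_, k, fun A hA => ?_, hk, fun q g' hq hg' =>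
    hkS.trans (csInf_le hbdd ⟨q, g', hq, hg', rfl⟩)⟩
  exact Eventually.of_forall (f := (hyperfilter ℕ : Filter ℕ)) fun n => hp n hA

end WeakLimits

section IsometricActions

variable {H : Type*} [NormedAddCommGroup H] [InnerProductSpace ℝ H] {G : Type*} [AddCommGroup G]

/-- A linear isometric action of an additive group. -/
structure IsIsometricAction (U : G → H →ₗᵢ[ℝ] H) : Prop where
  zero : ∀ f, U 0 f = f
  add : ∀ v w f, U (v + w) f = U v (U w f)

/-- The sum of two ultrafilters on an additive group. -/
def ultraAdd (p q : Ultrafilter G) : Ultrafilter G :=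
  p.bind fun w => q.map (w + ·)

theorem eventually_ultraAdd {p q : Ultrafilter G} {P : G → Prop} :
    (∀ᶠ x in ultraAdd p q, P x) ↔ ∀ᶠ v in p, ∀ᶠ w in q, P (v + w) :=
  Iff.rfl

theorem tendsto_ultraAdd {p q : Ultrafilter G} {t : G →+ ℝ} {a b : ℝ}
    (hp : Tendsto t p (𝓝 a)) (hq : Tendsto t q (𝓝 b)) :
    Tendsto t (ultraAdd p q) (𝓝 (a + b)) := by
  have h : Tendsto (fun x : G × G => t (x.1 + x.2)) ((p : Filter G) ×ˢ q) (𝓝 (a + b)) := by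
    simpa only [map_add, Function.comp_def] using (hp.comp tendsto_fst).add (hq.comp tendsto_snd)
  intro s hs
  have h' : ∀ᶠ x in (p : Filter G) ×ˢ q, t (x.1 + x.2) ∈ s := h hs
  exact eventually_ultraAdd.2 h'.curry

namespace IsIsometricAction

variable {U : G → H →ₗᵢ[ℝ] H} (hU : IsIsometricAction U)

include hU

theorem inner_left (w : G) (f h : H) : inner ℝ (U w f) h = inner ℝ f (U (-w) h) := by
  rw [← (U (-w)).inner_map_map, ← hU.add, neg_add_cancel, hU.zero]

theorem weakLim_add [CompleteSpace H] {p q : Ultrafilter G} {f g g' : H}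
    (hq : WeakLim (fun w => U w f) q g) (hp : WeakLim (fun w => U w g) p g') :
    WeakLim (fun w => U w f) (ultraAdd p q) g' := by
  obtain ⟨k, hk⟩ := exists_weakLim (u := fun w => U w f) (fun w => ((U w).norm_map f).le)
    (ultraAdd p q)
  have h : ∀ w, WeakLim (fun v => U v f) (map (w + ·) (q : Filter G)) (U w g) := by
    intro w h
    rw [hU.inner_left, tendsto_map'_iff]
    refine (hq (U (-w) h)).congr fun v => ?_
    simp only [Function.comp_apply, hU.add, hU.inner_left w]
  have hk' : WeakLim (fun w => U w f) ((p : Filter G).bind fun w => map (w + ·) (q : Filter G)) k :=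
    hk
  rwa [hp.unique (WeakLim.of_bind hk' h)]

end IsIsometricAction

end IsometricActions

section AlmostPeriodic

variable {H : Type*} [NormedAddCommGroup H] [InnerProductSpace ℝ H] {G : Type*} [AddCommGroup G]

theorem totallyBounded_image_iff {ι E : Type*} [UniformSpace E] {u : ι → E} {s : Set ι} :
    TotallyBounded (u '' s) ↔ ∀ p : Ultrafilter ι, s ∈ p → Cauchy (map u p) := by
  rw [totallyBounded_iff_ultrafilter]
  refine ⟨fun h p hp => h (p.map u) (le_principal_iff.2 (image_mem_map hp)), fun h q hq => ?_⟩
  have hq' : u '' s ∈ q := le_principal_iff.1 hq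
  have := h _ (Ultrafilter.ofComapInfPrincipal_mem hq')
  rwa [← Ultrafilter.coe_map, Ultrafilter.ofComapInfPrincipal_eq_of_map hq'] at this

/-- The filter of group elements `w` with `t w → 0` and `s w → ∞`. -/
noncomputable def farFilter (t : G →+ ℝ) (s : G → ℤ) : Filter G :=
  comap t (𝓝 0) ⊓ comap s atTop

theorem le_farFilter {t : G →+ ℝ} {s : G → ℤ} {l : Filter G} :
    l ≤ farFilter t s ↔ Tendsto t l (𝓝 0) ∧ Tendsto s l atTop := by
  rw [farFilter, le_inf_iff, tendsto_iff_comap, tendsto_iff_comap]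

theorem ultraAdd_le_farFilter {t : G →+ ℝ} {s : G →+ ℤ} {p q : Ultrafilter G}
    (hp : Tendsto t p (𝓝 0)) (hq : (q : Filter G) ≤ farFilter t s) :
    (ultraAdd p q : Filter G) ≤ farFilter t s := by
  rw [le_farFilter] at hq ⊢
  refine ⟨by simpa only [add_zero] using tendsto_ultraAdd hp hq.1, tendsto_atTop.2 fun N => ?_⟩
  refine eventually_ultraAdd.2 (Eventually.of_forall fun v => ?_)
  filter_upwards [tendsto_atTop.1 hq.2 (N - s v)] with w hw
  rw [map_add]
  linarith

/-- The vectors with totally bounded orbit along a strip `{w | |t w| ≤ C}`. -/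
def IsAlmostPeriodic (U : G → H →ₗᵢ[ℝ] H) (t : G →+ ℝ) (C : ℝ) (g : H) : Prop :=
  TotallyBounded ((fun w => U w g) '' {w | |t w| ≤ C})

namespace IsIsometricAction

variable {U : G → H →ₗᵢ[ℝ] H} (hU : IsIsometricAction U) {t : G →+ ℝ} {s : G →+ ℤ}

include hU

theorem isAlmostPeriodic_apply {C : ℝ} {g : H} (hg : IsAlmostPeriodic U t C g) (v : G) :
    IsAlmostPeriodic U t C (U v g) := by
  have h := TotallyBounded.image hg (U v).isometry.uniformContinuous
  rw [image_image] at h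
  simpa only [IsAlmostPeriodic, ← hU.add, add_comm] using h

theorem inner_weakLim_eq_zero {C : ℝ} {f g : H} {l : Filter G} [l.NeBot]
    (hf : ∀ h, IsAlmostPeriodic U t C h → inner ℝ f h = 0)
    (hg : WeakLim (fun w => U w f) l g) {h : H} (hh : IsAlmostPeriodic U t C h) :
    inner ℝ g h = 0 := by
  refine tendsto_nhds_unique (hg h) (tendsto_const_nhds.congr fun w => ?_)
  rw [hU.inner_left, hf _ (hU.isAlmostPeriodic_apply hh _)]

variable [CompleteSpace H]

theorem isAlmostPeriodic_of_norm_minimal {p : Ultrafilter G} {f g : H}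
    (hp : (p : Filter G) ≤ farFilter t s) (hg : WeakLim (fun w => U w f) p g)
    (hmin : ∀ (q : Ultrafilter G) (g' : H), (q : Filter G) ≤ farFilter t s →
      WeakLim (fun w => U w f) q g' → ‖g‖ ≤ ‖g'‖) (C : ℝ) :
    IsAlmostPeriodic U t C g := by
  refine totallyBounded_image_iff.2 fun q hq => ?_
  obtain ⟨τ, -, hτ⟩ := (isCompact_Icc (a := -C) (b := C)).ultrafilter_le_nhds (q.map t)
    (le_principal_iff.2 (mem_map.2 (mem_of_superset hq fun w hw => abs_le.1 hw)))
  replace hτ : Tendsto t q (𝓝 τ) := hτ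
  have hτ' : Tendsto t (q.map Neg.neg) (𝓝 (-τ)) :=
    tendsto_map'_iff.2 (hτ.neg.congr fun w => (map_neg t w).symm)
  have hbd : ∀ (f : H) (w : G), ‖U w f‖ ≤ ‖f‖ := fun f w => ((U w).norm_map f).le
  obtain ⟨k, hk⟩ := exists_weakLim (hbd g) q
  obtain ⟨k', hk'⟩ := exists_weakLim (hbd k) (q.map Neg.neg)
  have hsum : Tendsto t (ultraAdd (q.map Neg.neg) q) (𝓝 0) := by
    simpa only [neg_add_cancel] using tendsto_ultraAdd hτ' hτ
  have h1 : ‖g‖ ≤ ‖k'‖ := hmin _ _ (ultraAdd_le_farFilter hsum hp)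
    (hU.weakLim_add hg (hU.weakLim_add hk hk'))
  have h2 : ‖k'‖ ≤ ‖k‖ := hk'.norm_le tendsto_const_nhds (hbd k)
  exact (hk.tendsto fun w => (hbd g w).trans (h1.trans h2)).cauchy_map

/-- A vector orthogonal to the almost periodic vectors has `0` as a weak limit point. -/
theorem exists_weakLim_zero [(farFilter t s).NeBot] {C : ℝ} {f : H}
    (hf : ∀ h, IsAlmostPeriodic U t C h → inner ℝ f h = 0) :
    ∃ p : Ultrafilter G, (p : Filter G) ≤ farFilter t s ∧ WeakLim (fun w => U w f) p 0 := by
  obtain ⟨p, g, hp, hg, hmin⟩ := exists_weakLim_norm_minimal U (farFilter t s) f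
  have h := hU.isAlmostPeriodic_of_norm_minimal hp hg hmin C
  have hg0 : g = 0 := inner_self_eq_zero.1 (hU.inner_weakLim_eq_zero hf hg h)
  exact ⟨p, hp, hg0 ▸ hg⟩

theorem exists_forall_weakLim_zero [(farFilter t s).NeBot] {C : ℝ} (A : Set H) (hA : A.Finite)
    (hf : ∀ f ∈ A, ∀ h, IsAlmostPeriodic U t C h → inner ℝ f h = 0) :
    ∃ p : Ultrafilter G, (p : Filter G) ≤ farFilter t s ∧
      ∀ f ∈ A, WeakLim (fun w => U w f) p 0 := by
  induction A, hA using Set.Finite.induction_on with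
  | empty => exact ⟨Ultrafilter.of _, Ultrafilter.of_le _, by simp⟩
  | @insert a A _ _ ih =>
    obtain ⟨p, hp, hpA⟩ := ih fun f hfA => hf f (mem_insert_of_mem a hfA)
    obtain ⟨g, hg⟩ := exists_weakLim (u := fun w => U w a) (fun w => ((U w).norm_map a).le) p
    obtain ⟨q, hq, hqg⟩ := hU.exists_weakLim_zero (s := s) (C := C) (f := g) fun h hh =>
      hU.inner_weakLim_eq_zero (hf a (mem_insert a A)) hg hh
    refine ⟨ultraAdd q p, ultraAdd_le_farFilter (le_farFilter.1 hq).1 hp, fun f hfA => ?_⟩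
    rcases hfA with rfl | hfA
    · exact hU.weakLim_add hg hqg
    · refine hU.weakLim_add (hpA f hfA) fun h => ?_
      simp only [map_zero]
      exact tendsto_const_nhds

/-- Finitely many vectors orthogonal to the almost periodic vectors tend weakly to `0`
along a common sequence. -/
theorem exists_seq_weakLim_zero [SecondCountableTopology H] [(farFilter t s).NeBot] {C : ℝ}
    (A : Set H) (hA : A.Finite)
    (hf : ∀ f ∈ A, ∀ h, IsAlmostPeriodic U t C h → inner ℝ f h = 0) :
    ∃ w : ℕ → G, Tendsto w atTop (farFilter t s) ∧
      ∀ f ∈ A, WeakLim (fun i => U (w i) f) atTop 0 := by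
  obtain ⟨p, hp, hpA⟩ := hU.exists_forall_weakLim_zero (s := s) A hA hf
  have := hA.countable.to_subtype
  let D := TopologicalSpace.denseSeq H
  let Φ : Filter G := farFilter t s ⊓
    ⨅ x : A × ℕ, comap (fun w => inner ℝ (U w x.1) (D x.2)) (𝓝 (0 : ℝ))
  have hΦ : (p : Filter G) ≤ Φ := by
    refine le_inf hp (le_iInf fun x => tendsto_iff_comap.1 ?_)
    simpa only [inner_zero_left] using hpA x.1 x.1.2 (D x.2)
  have : Φ.NeBot := neBot_of_le hΦ
  have : Φ.IsCountablyGenerated := by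
    simp only [Φ, farFilter]
    infer_instance
  obtain ⟨w, hw⟩ := exists_seq_tendsto Φ
  refine ⟨w, hw.mono_right inf_le_left, fun f hfA h => ?_⟩
  have hD : ∀ j, Tendsto (fun i => inner ℝ (U (w i) f) (D j)) atTop (𝓝 (0 : ℝ)) := fun j =>
    tendsto_comap_iff.1 (hw.mono_right (inf_le_right.trans (iInf_le _ ((⟨f, hfA⟩ : A), j))))
  rw [inner_zero_left, Metric.tendsto_nhds]
  intro ε hε
  have hpos : 0 < ε / (2 * (‖f‖ + 1)) := by positivity
  obtain ⟨j, hj⟩ := (TopologicalSpace.denseRange_denseSeq H).exists_dist_lt h hpos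
  filter_upwards [Metric.tendsto_nhds.1 (hD j) (ε / 2) (half_pos hε)] with i hi
  rw [dist_zero_right] at hi ⊢
  have h1 : inner ℝ (U (w i) f) h
      = inner ℝ (U (w i) f) (D j) + inner ℝ (U (w i) f) (h - D j) := by
    rw [← inner_add_right, add_sub_cancel]
  have h2 : ‖inner ℝ (U (w i) f) (h - D j)‖ ≤ ‖f‖ * (ε / (2 * (‖f‖ + 1))) := by
    refine (norm_inner_le_norm _ _).trans ?_
    rw [(U (w i)).norm_map, ← dist_eq_norm]
    exact mul_le_mul_of_nonneg_left hj.le (norm_nonneg f)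
  have h3 : ‖f‖ * (ε / (2 * (‖f‖ + 1))) ≤ ε / 2 := by
    rw [mul_div_assoc', div_le_div_iff₀ (by positivity) two_pos]
    nlinarith [norm_nonneg f]
  rw [h1]
  exact (norm_add_le _ _).trans_lt (by linarith)

end IsIsometricAction

end AlmostPeriodic

section Koopman

variable {X : Type*} [MeasurableSpace X] {μ : Measure X}

theorem measureReal_le_abs_le_norm_sq_div (F : Lp ℝ 2 μ) {η : ℝ} (hη : 0 < η) :
    μ.real {x | η ≤ |F x|} ≤ ‖F‖ ^ 2 / η ^ 2 := by
  rw [le_div_iff₀ (by positivity), mul_comm, ← real_inner_self_eq_norm_sq, L2.inner_def]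
  have h := mul_meas_ge_le_integral_of_nonneg (μ := μ) (f := fun x => inner ℝ (F x) (F x))
    (Eventually.of_forall fun x => real_inner_self_nonneg) (L2.integrable_inner F F) (η ^ 2)
  simpa only [real_inner_self_eq_norm_sq, Real.norm_eq_abs,
    pow_le_pow_iff_left₀ hη.le (abs_nonneg _) two_ne_zero] using h

/-- The Koopman operator of a measure-preserving map. -/
noncomputable def koopman {T : ℤ × ℤ → X → X} (hT : ∀ w, MeasurePreserving (T w) μ μ)
    (w : ℤ × ℤ) : Lp ℝ 2 μ →ₗᵢ[ℝ] Lp ℝ 2 μ :=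
  Lp.compMeasurePreservingₗᵢ ℝ (T w) (hT w)

variable {T : ℤ × ℤ → X → X} (hT : ∀ w, MeasurePreserving (T w) μ μ)

include hT

theorem koopman_ae_eq (w : ℤ × ℤ) (f : Lp ℝ 2 μ) : koopman hT w f =ᵐ[μ] fun x => f (T w x) :=
  Lp.coeFn_compMeasurePreserving f (hT w)

theorem koopman_ae_eq_of_ae_eq (w : ℤ × ℤ) {f : Lp ℝ 2 μ} {φ : X → ℝ} (h : f =ᵐ[μ] φ) :
    koopman hT w f =ᵐ[μ] fun x => φ (T w x) :=
  (koopman_ae_eq hT w f).trans ((hT w).quasiMeasurePreserving.ae_eq_comp h)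

theorem isIsometricAction_koopman (h0 : T 0 = id) (hadd : ∀ v w, T (v + w) = T v ∘ T w) :
    IsIsometricAction (koopman hT) where
  zero f := Lp.ext <| by
    filter_upwards [koopman_ae_eq hT 0 f] with x hx
    rw [hx, h0, id]
  add v w f := Lp.ext <| by
    filter_upwards [koopman_ae_eq hT (v + w) f,
      koopman_ae_eq_of_ae_eq hT v (koopman_ae_eq hT w f)] with x h1 h2
    rw [h1, h2, add_comm, hadd, Function.comp_apply]

variable [IsProbabilityMeasure μ]

theorem dist_koopman_indicator_lt {g : Lp ℝ 2 μ} {a : ℝ} (ha : μ {x | g x = a} = 0)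
    (hB : MeasurableSet {x | a < g x}) {ε : ℝ} (hε : 0 < ε) :
    ∃ δ > 0, ∀ v w, dist (koopman hT v g) (koopman hT w g) < δ →
      dist (koopman hT v (indicatorConstLp 2 hB (measure_ne_top μ _) 1))
        (koopman hT w (indicatorConstLp 2 hB (measure_ne_top μ _) 1)) < ε := by
  have hg : Measurable g := (Lp.stronglyMeasurable g).measurable
  obtain ⟨η, hη, hηa⟩ : ∃ η > 0, μ.real {x | |g x - a| ≤ η} < ε ^ 2 / 2 := by
    have h := tendsto_measure_cthickening_of_isClosed (μ := μ.map g) (s := {a})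
      ⟨1, one_pos, measure_ne_top _ _⟩ isClosed_singleton
    rw [Measure.map_apply hg (measurableSet_singleton a)] at h
    have h0 : μ (g ⁻¹' {a}) < ENNReal.ofReal (ε ^ 2 / 2) :=
      ha.trans_lt (ENNReal.ofReal_pos.2 (by positivity))
    have h' := (h.mono_left (nhdsWithin_le_nhds (s := Ioi 0))).eventually_lt_const h0
    obtain ⟨η, hηa, hη⟩ := (h'.and self_mem_nhdsWithin).exists
    refine ⟨η, hη, ?_⟩
    rw [Metric.cthickening_singleton _ (le_of_lt hη),
      Measure.map_apply hg Metric.isClosed_closedBall.measurableSet] at hηa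
    rw [measureReal_def]
    exact ENNReal.toReal_lt_of_lt_ofReal hηa
  refine ⟨η * (ε / 2), by positivity, fun v w hvw => ?_⟩
  have hsub : symmDiff (T v ⁻¹' {x | a < g x}) (T w ⁻¹' {x | a < g x}) ≤ᵐ[μ]
      ((T v ⁻¹' {x | |g x - a| ≤ η}) ∪
        {x | η ≤ |(koopman hT v g - koopman hT w g : Lp ℝ 2 μ) x|} : Set X) := by
    filter_upwards [koopman_ae_eq hT v g, koopman_ae_eq hT w g,
      Lp.coeFn_sub (koopman hT v g) (koopman hT w g)] with x hv hw hs hx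
    by_contra hcon
    have hcon' : ¬ (|g (T v x) - a| ≤ η ∨
      η ≤ |(koopman hT v g - koopman hT w g : Lp ℝ 2 μ) x|) := hcon
    rw [hs, Pi.sub_apply, hv, hw, not_or, not_le, not_le] at hcon'
    have h2 := abs_lt.1 hcon'.2
    rcases hx with ⟨h3, h4⟩ | ⟨h3, h4⟩
    · have h3' : a < g (T v x) := h3
      have h4' : ¬ a < g (T w x) := h4
      rw [abs_of_pos (by linarith)] at hcon'
      linarith
    · have h3' : a < g (T w x) := h3
      have h4' : ¬ a < g (T v x) := h4
      rw [abs_of_nonpos (by linarith)] at hcon'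
      linarith
  have hmeas : μ.real (symmDiff (T v ⁻¹' {x | a < g x}) (T w ⁻¹' {x | a < g x})) < ε ^ 2 := by
    have h1 : μ.real (T v ⁻¹' {x | |g x - a| ≤ η}) < ε ^ 2 / 2 := by
      rwa [measureReal_def, (hT v).measure_preimage
        (measurableSet_le (by fun_prop) measurable_const).nullMeasurableSet]
    have h2 : μ.real {x | η ≤ |(koopman hT v g - koopman hT w g : Lp ℝ 2 μ) x|} ≤ ε ^ 2 / 4 := by
      refine (measureReal_le_abs_le_norm_sq_div _ hη).trans ?_
      rw [div_le_iff₀ (by positivity), ← dist_eq_norm]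
      nlinarith [pow_le_pow_left₀ dist_nonneg hvw.le 2]
    have h3 := (ENNReal.toReal_mono (measure_ne_top _ _) (measure_mono_ae hsub)).trans
      (measureReal_union_le (μ := μ) (T v ⁻¹' {x | |g x - a| ≤ η})
        {x | η ≤ |(koopman hT v g - koopman hT w g : Lp ℝ 2 μ) x|})
    have h4 : 0 < ε ^ 2 := by positivity
    exact h3.trans_lt (by linarith)
  change dist (Lp.compMeasurePreserving _ _ _) (Lp.compMeasurePreserving _ _ _) < ε
  rw [Lp.indicatorConstLp_compMeasurePreserving, Lp.indicatorConstLp_compMeasurePreserving,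
    dist_indicatorConstLp_eq_norm, norm_indicatorConstLp two_ne_zero ENNReal.ofNat_ne_top,
    norm_one, one_mul, ENNReal.toReal_ofNat, ← Real.sqrt_eq_rpow]
  exact (Real.sqrt_lt' hε).2 hmeas

end Koopman

section Strip

/-- The homomorphism `(m, n) ↦ n - β m`, which measures the distance to the line of slope `β`. -/
noncomputable def lineDist (β : ℝ) : ℤ × ℤ →+ ℝ where
  toFun p := p.2 - β * p.1
  map_zero' := by simp
  map_add' p q := by
    simp only [Prod.fst_add, Prod.snd_add, Int.cast_add]
    ring

theorem mem_Lam_iff {β b : ℝ} {w : ℤ × ℤ} : w ∈ Lam β b ↔ |lineDist β w| ≤ b / 2 := by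
  change (β * w.1 - b / 2 ≤ w.2 ∧ w.2 ≤ β * w.1 + b / 2) ↔ |(w.2 : ℝ) - β * w.1| ≤ b / 2
  rw [abs_le]
  constructor <;> rintro ⟨h1, h2⟩ <;> constructor <;> linarith

theorem farFilter_lineDist_neBot (β : ℝ) :
    (farFilter (lineDist β) (AddMonoidHom.fst ℤ ℤ)).NeBot := by
  have h : ∀ n : ℕ, ∃ w : ℤ × ℤ, |lineDist β w| ≤ 1 / ((n : ℝ) + 1) ∧ (n : ℤ) ≤ w.1 := by
    intro n
    obtain ⟨j, k, hk, -, hjk⟩ :=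
      Real.exists_int_int_abs_mul_sub_le (β * ((n : ℝ) + 1)) n.succ_pos
    refine ⟨(k * (n + 1), j), ?_, by nlinarith⟩
    change |(j : ℝ) - β * ((k * (n + 1) : ℤ) : ℝ)| ≤ _
    rw [abs_sub_comm]
    push_cast at hjk ⊢
    rw [show β * (k * ((n : ℝ) + 1)) - j = k * (β * ((n : ℝ) + 1)) - j by ring]
    refine hjk.trans (one_div_le_one_div_of_le (by positivity) (by linarith))
  choose w hw hw' using h
  have hle : map w atTop ≤ farFilter (lineDist β) (AddMonoidHom.fst ℤ ℤ) := by
    refine le_farFilter.2 ⟨tendsto_map'_iff.2 ?_, tendsto_map'_iff.2 ?_⟩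
    · exact squeeze_zero_norm hw tendsto_one_div_add_atTop_nhds_zero_nat
    · exact tendsto_atTop_mono hw' tendsto_natCast_atTop_atTop
  exact neBot_of_le hle

end Strip

section DirectionalKronecker

variable {X : Type*} {mX : MeasurableSpace X} {μ : Measure X}

theorem dirKronAlg_le (T : ℤ × ℤ → X → X) (β : ℝ) : dirKronAlg μ T β ≤ mX :=
  MeasurableSpace.generateFrom_le fun _ hB => hB.1

variable [IsProbabilityMeasure μ] {T : ℤ × ℤ → X → X} (hT : ∀ w, MeasurePreserving (T w) μ μ)

include hT

theorem superlevel_mem_dirKron {β : ℝ} {g : Lp ℝ 2 μ}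
    (hg : IsAlmostPeriodic (koopman hT) (lineDist β) (1 / 2) g) {a : ℝ}
    (ha : μ {x | g x = a} = 0) : {x | a < g x} ∈ dirKron μ T β 1 := by
  have hB : MeasurableSet {x | a < g x} :=
    measurableSet_lt measurable_const (Lp.stronglyMeasurable g).measurable
  refine ⟨hB, ?_⟩
  have hsub : korbit μ T (Lam β 1) {x | a < g x} ⊆
      (fun w => koopman hT w (indicatorConstLp 2 hB (measure_ne_top μ _) 1)) ''
        {w | |lineDist β w| ≤ 1 / 2} := by
    rintro f ⟨w, hw, hf⟩
    exact ⟨w, mem_Lam_iff.1 hw, Lp.ext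
      ((koopman_ae_eq_of_ae_eq hT w indicatorConstLp_coeFn).trans hf.symm)⟩
  refine TotallyBounded.isCompact_of_isClosed (TotallyBounded.closure (.subset hsub ?_))
    isClosed_closure
  refine totallyBounded_image_iff.2 fun p hp => Metric.cauchy_iff.2 ⟨inferInstance, fun ε hε => ?_⟩
  obtain ⟨δ, hδ, h⟩ := dist_koopman_indicator_lt hT ha hB hε
  obtain ⟨S, hS, hSδ⟩ := (Metric.cauchy_iff.1 (totallyBounded_image_iff.1 hg p hp)).2 δ hδ
  refine ⟨_, image_mem_map (mem_map.1 hS), ?_⟩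
  rintro _ ⟨v, hv, rfl⟩ _ ⟨w, hw, rfl⟩
  exact h v w (hSδ _ hv _ hw)

theorem measurable_of_isAlmostPeriodic {β : ℝ} {g : Lp ℝ 2 μ}
    (hg : IsAlmostPeriodic (koopman hT) (lineDist β) (1 / 2) g) :
    Measurable[dirKronAlg μ T β] g := by
  have hcount : {a : ℝ | 0 < μ {x | g x = a}}.Countable :=
    Measure.countable_meas_level_set_pos (Lp.stronglyMeasurable g).measurable
  have hdense : Dense {a : ℝ | μ {x | g x = a} = 0} := by
    convert hcount.dense_compl ℝ using 1
    ext a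
    simp
  refine @measurable_of_Ioi ℝ X _ _ _ (dirKronAlg μ T β) _ _ _ _ fun a => ?_
  obtain ⟨u, -, hu, hlim⟩ := hdense.exists_seq_strictAnti_tendsto a
  have hunion : g ⁻¹' Ioi a = ⋃ n, {x | u n < g x} := by
    ext x
    refine ⟨fun hx => mem_iUnion.2 (hlim.eventually_lt_const hx).exists, fun hx => ?_⟩
    obtain ⟨n, hn⟩ := mem_iUnion.1 hx
    exact lt_trans (show a < u n from (hu n).1) (show u n < g x from hn)
  rw [hunion]
  exact MeasurableSet.iUnion fun n =>
    MeasurableSpace.measurableSet_generateFrom (superlevel_mem_dirKron hT hg (hu n).2)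

/-- The deviation of `φ` from its conditional expectation on the directional Kronecker algebra is
orthogonal to the almost periodic functions. -/
theorem inner_sub_condExp_eq_zero {β : ℝ} {φ : X → ℝ} (hφ : MemLp φ 2 μ) {f g : Lp ℝ 2 μ}
    (hf : f =ᵐ[μ] φ - μ[φ | dirKronAlg μ T β])
    (hg : IsAlmostPeriodic (koopman hT) (lineDist β) (1 / 2) g) : inner ℝ f g = 0 := by
  have hm := measurable_of_isAlmostPeriodic hT hg
  have hle := dirKronAlg_le (μ := μ) T β
  have hint : Integrable (φ * (g : X → ℝ)) μ := hφ.integrable_mul (Lp.memLp g)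
  have hint' : Integrable (μ[φ | dirKronAlg μ T β] * (g : X → ℝ)) μ :=
    (hφ.condExp one_le_two).integrable_mul (Lp.memLp g)
  have h1 : ∫ x, (φ * (g : X → ℝ)) x ∂μ = ∫ x, (μ[φ | dirKronAlg μ T β] * (g : X → ℝ)) x ∂μ := by
    rw [← integral_condExp hle]
    exact integral_congr_ae (condExp_mul_of_stronglyMeasurable_right hm.stronglyMeasurable hint
      (hφ.integrable one_le_two))
  rw [L2.inner_def, ← sub_eq_zero.2 h1, ← integral_sub hint hint']
  refine integral_congr_ae ?_
  filter_upwards [hf] with x hx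
  rw [hx]
  simp only [RCLike.inner_apply, conj_trivial, Pi.sub_apply, Pi.mul_apply]
  ring

end DirectionalKronecker

/-- there is an infinite subset of the strip, with strictly
monotone first coordinates, along which `U_T^{(m,n)}(1_D - 𝔼(1_D | 𝒦^v_μ))`
converges weakly to `0` for every cell `D` of the partition. -/
theorem exists_weakly_null_sequence
    {X : Type*} [MetricSpace X] [CompactSpace X] [MeasurableSpace X] [BorelSpace X]
    (μ : Measure X) [IsProbabilityMeasure μ] (T : ℤ × ℤ → X → X)
    (hT : IsZ2MPS μ T) (β b : ℝ) (hb : 0 < b)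
    (𝔠 : Finset (Set X)) (h𝔠 : IsPartition 𝔠) :
    ∃ w : ℕ → ℤ × ℤ, EnumIn w (Lam β b) ∧
      (StrictMono (fun i => (w i).1) ∨ StrictAnti (fun i => (w i).1)) ∧
      ∀ D ∈ 𝔠, ∀ B : Set X, MeasurableSet B →
        Tendsto (fun i => ∫ x in B,
            (D.indicator (fun _ => (1 : ℝ)) (T (w i) x)
              - (μ[D.indicator (fun _ => (1 : ℝ)) | dirKronAlg μ T β]) (T (w i) x)) ∂μ)
          atTop (𝓝 0) := by
  obtain ⟨-, h0, hadd, hmp⟩ := hT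
  have hφ (D : 𝔠) : MemLp ((D : Set X).indicator fun _ => (1 : ℝ)) 2 μ :=
    memLp_indicator_const 2 (h𝔠.1 D D.2) 1 (Or.inr (measure_ne_top _ _))
  let f (D : 𝔠) : Lp ℝ 2 μ :=
    ((hφ D).sub ((hφ D).condExp (m := dirKronAlg μ T β) one_le_two)).toLp _
  have hf (D : 𝔠) : f D =ᵐ[μ] (D : Set X).indicator (fun _ => (1 : ℝ)) -
      μ[(D : Set X).indicator fun _ => (1 : ℝ) | dirKronAlg μ T β] := MemLp.coeFn_toLp _
  have := farFilter_lineDist_neBot β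
  have : Fact ((2 : ℝ≥0∞) ≠ ∞) := ⟨ENNReal.ofNat_ne_top⟩
  obtain ⟨w, hw, hlim⟩ := (isIsometricAction_koopman hmp h0 hadd).exists_seq_weakLim_zero
    (t := lineDist β) (s := AddMonoidHom.fst ℤ ℤ) (C := 1 / 2) (Set.range f) (Set.finite_range f)
    (by
      rintro _ ⟨D, rfl⟩ h hh
      exact inner_sub_condExp_eq_zero hmp (hφ D) (hf D) hh)
  obtain ⟨hwt, hws⟩ := le_farFilter.1 hw
  obtain ⟨N, hN⟩ := eventually_atTop.1
    ((hwt.comp tendsto_map).norm.eventually_le_const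
      (show ‖(0 : ℝ)‖ < b / 2 by simpa using hb))
  obtain ⟨ψ, hψ, hmono⟩ := strictMono_subseq_of_tendsto_atTop
    ((hws.comp tendsto_map).comp (tendsto_add_atTop_nat N))
  have hmono' : StrictMono fun i => (w (ψ i + N)).1 := hmono
  refine ⟨fun i => w (ψ i + N), ⟨fun i j hij => hmono'.injective (congrArg Prod.fst hij),
    fun i => mem_Lam_iff.2 (hN _ (Nat.le_add_left _ _))⟩, Or.inl hmono', fun D hD B hB => ?_⟩
  have hlim' := ((hlim _ ⟨⟨D, hD⟩, rfl⟩ (indicatorConstLp 2 hB (measure_ne_top μ B) 1)).comp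
    (tendsto_add_atTop_nat N)).comp hψ.tendsto_atTop
  rw [inner_zero_left] at hlim'
  refine hlim'.congr fun i => ?_
  simp only [Function.comp_apply]
  rw [real_inner_comm, L2.inner_indicatorConstLp_one]
  exact integral_congr_ae (ae_restrict_of_ae (koopman_ae_eq_of_ae_eq hmp _ (hf ⟨D, hD⟩)))

end Directional
end
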